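/- Let C be the directed graph with two vertices v₁, v₂ and countably infinitely many edges f₁, f₂, f₃, …, each with source v₁ and range v₂, and let R be a nonzero associative unital ring. Equip S = L_R(C) with its canonical ℤ-gradation S = ⊕_{n∈ℤ} S_n. Then v₁ ∉ S₁ S₋₁; consequently, L_R(C) is not epsilon-strongly ℤ-graded. -/

import Mathlib

namespace LPA

/-- Generators of the Leavitt path algebra: a vertex `v`, a (real) edge `f`,
or a ghost edge `f*`. -/
inductive Gen (V Ed : Type*) : Type _
  | vertex : V → Gen V Ed
  | edge : Ed → Gen V Ed
  | ghost : Ed → Gen V Ed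

/-- The free `R`-ring on the generators, with `R` commuting with the generators. -/
abbrev FreeLPA (R V Ed : Type*) [Ring R] : Type _ := MonoidAlgebra R (FreeMonoid (Gen V Ed))

noncomputable def genF (R : Type*) [Ring R] {V Ed : Type*} (x : Gen V Ed) : FreeLPA R V Ed :=
  MonoidAlgebra.of R (FreeMonoid (Gen V Ed)) (FreeMonoid.of x)

/-- The defining relations of the Leavitt path algebra of the graph with vertices `V`,
edges `Ed`, source map `sf` and range map `rf`. -/
inductive Rel (R : Type*) [Ring R] {V Ed : Type*} (sf rf : Ed → V) :
    FreeLPA R V Ed → FreeLPA R V Ed → Prop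
  | vertex_eq (v : V) :
      Rel R sf rf (genF R (Gen.vertex v) * genF R (Gen.vertex v)) (genF R (Gen.vertex v))
  | vertex_ne {v w : V} (h : v ≠ w) :
      Rel R sf rf (genF R (Gen.vertex v) * genF R (Gen.vertex w)) 0
  | src_edge (f : Ed) :
      Rel R sf rf (genF R (Gen.vertex (sf f)) * genF R (Gen.edge f)) (genF R (Gen.edge f))
  | edge_rng (f : Ed) :
      Rel R sf rf (genF R (Gen.edge f) * genF R (Gen.vertex (rf f))) (genF R (Gen.edge f))
  | rng_ghost (f : Ed) :
      Rel R sf rf (genF R (Gen.vertex (rf f)) * genF R (Gen.ghost f)) (genF R (Gen.ghost f))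
  | ghost_src (f : Ed) :
      Rel R sf rf (genF R (Gen.ghost f) * genF R (Gen.vertex (sf f))) (genF R (Gen.ghost f))
  | ghost_edge_eq (f : Ed) :
      Rel R sf rf (genF R (Gen.ghost f) * genF R (Gen.edge f)) (genF R (Gen.vertex (rf f)))
  | ghost_edge_ne {f f' : Ed} (h : f ≠ f') :
      Rel R sf rf (genF R (Gen.ghost f) * genF R (Gen.edge f')) 0
  | cuntz_krieger (v : V) (h1 : {f : Ed | sf f = v}.Nonempty) (h2 : {f : Ed | sf f = v}.Finite) :
      Rel R sf rf (∑ f ∈ h2.toFinset, genF R (Gen.edge f) * genF R (Gen.ghost f))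
        (genF R (Gen.vertex v))

/-- The Leavitt path algebra `L_R(E)` (as the ambient unital quotient ring in which the
span of the monomials `α β*` is the Leavitt path algebra). -/
abbrev LeavittPathAlgebra (R : Type*) [Ring R] {V Ed : Type*} (sf rf : Ed → V) : Type _ :=
  RingQuot (Rel R sf rf)

noncomputable def gen (R : Type*) [Ring R] {V Ed : Type*} (sf rf : Ed → V) (x : Gen V Ed) :
    LeavittPathAlgebra R sf rf :=
  RingQuot.mkRingHom (Rel R sf rf) (genF R x)

noncomputable def ofR (R : Type*) [Ring R] {V Ed : Type*} (sf rf : Ed → V) (r : R) :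
    LeavittPathAlgebra R sf rf :=
  RingQuot.mkRingHom (Rel R sf rf) (MonoidAlgebra.single (1 : FreeMonoid (Gen V Ed)) r)

/-- Paths in the directed graph. `GPath sf rf u w` are the paths with source `u`
and range `w`; a vertex is a path of length `0`. -/
inductive GPath {V Ed : Type*} (sf rf : Ed → V) : V → V → Type _
  | nil (v : V) : GPath sf rf v v
  | cons (f : Ed) {w : V} (p : GPath sf rf (rf f) w) : GPath sf rf (sf f) w

namespace GPath

def length {V Ed : Type*} {sf rf : Ed → V} : {u w : V} → GPath sf rf u w → ℕ
  | _, _, nil _ => 0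
  | _, _, cons _ p => length p + 1

def edgeList {V Ed : Type*} {sf rf : Ed → V} : {u w : V} → GPath sf rf u w → List Ed
  | _, _, nil _ => []
  | _, _, cons f p => f :: edgeList p

/-- The degree of a path with respect to a degree map `dg : Ed → G`. -/
def degree {V Ed : Type*} {sf rf : Ed → V} {G : Type*} [Group G] (dg : Ed → G) :
    {u w : V} → GPath sf rf u w → G
  | _, _, nil _ => 1
  | _, _, cons f p => dg f * degree dg p

end GPath

/-- The element `α` of `L_R(E)` associated to a path `α` (a vertex if `α` has length 0). -/
noncomputable def realElem (R : Type*) [Ring R] {V Ed : Type*} (sf rf : Ed → V) :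
    {u w : V} → GPath sf rf u w → LeavittPathAlgebra R sf rf
  | _, _, .nil v => gen R sf rf (Gen.vertex v)
  | _, _, .cons f p => gen R sf rf (Gen.edge f) * realElem R sf rf p

/-- The element `α* = α_n* ⋯ α_1*` of `L_R(E)` associated to a path `α`. -/
noncomputable def ghostElem (R : Type*) [Ring R] {V Ed : Type*} (sf rf : Ed → V) :
    {u w : V} → GPath sf rf u w → LeavittPathAlgebra R sf rf
  | _, _, .nil v => gen R sf rf (Gen.vertex v)
  | _, _, .cons f p => ghostElem R sf rf p * gen R sf rf (Gen.ghost f)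

/-- The product `AB` of two additive subgroups of a ring: the additive subgroup
generated by all products `ab`, `a ∈ A`, `b ∈ B`. -/
def sgMul {A : Type*} [NonUnitalRing A] (B C : AddSubgroup A) : AddSubgroup A :=
  AddSubgroup.closure {x | ∃ b ∈ B, ∃ c ∈ C, x = b * c}

/-- The homogeneous component `S_g` of the standard `G`-gradation of `L_R(E)` attached
to the degree map `dg : Ed → G`: the `R`-span of the monomials `α β*` with
`r(α) = r(β)` and `deg α * (deg β)⁻¹ = g`. -/
noncomputable def component (R : Type*) [Ring R] {V Ed : Type*} (sf rf : Ed → V) {G : Type*} [Group G]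
    (dg : Ed → G) (g : G) : AddSubgroup (LeavittPathAlgebra R sf rf) :=
  AddSubgroup.closure
    {x | ∃ (r : R) (u u' w : V) (α : GPath sf rf u w) (β : GPath sf rf u' w),
      α.degree dg * (β.degree dg)⁻¹ = g ∧
      x = ofR R sf rf r * (realElem R sf rf α * ghostElem R sf rf β)}

/-- The homogeneous component `S_n` of the canonical `ℤ`-gradation of `L_R(E)`:
the `R`-span of the monomials `α β*` with `r(α) = r(β)` and `l(α) - l(β) = n`. -/
noncomputable def componentZ (R : Type*) [Ring R] {V Ed : Type*} (sf rf : Ed → V) (n : ℤ) :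
    AddSubgroup (LeavittPathAlgebra R sf rf) :=
  AddSubgroup.closure
    {x | ∃ (r : R) (u u' w : V) (α : GPath sf rf u w) (β : GPath sf rf u' w),
      (α.length : ℤ) - (β.length : ℤ) = n ∧
      x = ofR R sf rf r * (realElem R sf rf α * ghostElem R sf rf β)}

end LPA

namespace LPA

/-- The source map of the graph `C`: two vertices `0, 1` and countably infinitely many
edges `f₀, f₁, f₂, …`, each with source `0`. -/
def sC : ℕ → Fin 2 := fun _ => 0

/-- The range map of the graph `C`: every edge has range `1`. -/
def rC : ℕ → Fin 2 := fun _ => 1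

/-- The operators by which the generators of `L_R(C)` act on the left `R`-module `R × (ℕ → R)`:
the first factor is the range of `v₂`, the second the range of `v₁`, and the edge `f_k` maps the
first factor onto the `k`-th coordinate of the second. -/
noncomputable def genAction (R : Type*) [Ring R] : Gen (Fin 2) ℕ → Module.End R (R × (ℕ → R))
  | .vertex v => if v = 0 then .inr R R (ℕ → R) ∘ₗ .snd R R (ℕ → R)
      else .inl R R (ℕ → R) ∘ₗ .fst R R (ℕ → R)
  | .edge k => .inr R R (ℕ → R) ∘ₗ .single R (fun _ => R) k ∘ₗ .fst R R (ℕ → R)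
  | .ghost k => .inl R R (ℕ → R) ∘ₗ .proj k ∘ₗ .snd R R (ℕ → R)

/-- The action of the free ring on the generators on `R × (ℕ → R)` extending `genAction`. -/
noncomputable def freeAction (R : Type*) [Ring R] :
    FreeLPA R (Fin 2) ℕ →+* AddMonoid.End (R × (ℕ → R)) :=
  MonoidAlgebra.liftNCRingHom (Module.toAddMonoidEnd R (R × (ℕ → R)))
    ((Module.toAddMonoidEnd (Module.End R (R × (ℕ → R))) (R × (ℕ → R))).toMonoidHom.comp
      (FreeMonoid.lift (genAction R)))
    (fun r w => AddMonoidHom.ext fun x => ((FreeMonoid.lift (genAction R) w).map_smul r x).symm)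

lemma freeAction_genF (R : Type*) [Ring R] (x : Gen (Fin 2) ℕ) (m : R × (ℕ → R)) :
    freeAction R (genF R x) m = genAction R x m := by
  have h : freeAction R (genF R x) =
      Module.toAddMonoidEnd (Module.End R (R × (ℕ → R))) (R × (ℕ → R)) (genAction R x) := by
    simp [freeAction, genF, MonoidAlgebra.liftNCRingHom]
  rw [h]
  rfl

lemma freeAction_genF_mul (R : Type*) [Ring R] (x y : Gen (Fin 2) ℕ) (m : R × (ℕ → R)) :
    freeAction R (genF R x * genF R y) m = genAction R x (genAction R y m) := by
  rw [map_mul, ← freeAction_genF, ← freeAction_genF]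
  rfl

lemma freeAction_rel (R : Type*) [Ring R] {a b : FreeLPA R (Fin 2) ℕ} (h : Rel R sC rC a b) :
    freeAction R a = freeAction R b := by
  refine DFunLike.ext _ _ fun m => ?_
  cases h with
  | cuntz_krieger v h1 h2 =>
    obtain ⟨f, rfl⟩ := h1
    exact absurd (h2.subset fun _ _ => rfl) (Set.infinite_univ (α := ℕ))
  | vertex_eq v =>
    rw [freeAction_genF_mul, freeAction_genF]
    fin_cases v <;> simp [genAction]
  | @vertex_ne v w h =>
    rw [freeAction_genF_mul, map_zero]
    change _ = 0
    fin_cases v <;> fin_cases w <;> simp_all [genAction]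
  | ghost_edge_ne h =>
    rw [freeAction_genF_mul, map_zero]
    change _ = 0
    simp [genAction, h]
  | _ =>
    rw [freeAction_genF_mul, freeAction_genF]
    simp [genAction, sC, rC]

lemma gen_edge_ne_zero (R : Type*) [Ring R] [Nontrivial R] (k : ℕ) :
    gen R sC rC (.edge k) ≠ 0 := by
  intro h
  have h0 := congrArg (RingQuot.lift ⟨freeAction R, fun _ _ => freeAction_rel R⟩) h
  rw [gen, RingQuot.lift_mkRingHom_apply, map_zero] at h0
  have h1 := congrFun (congrArg Prod.snd (DFunLike.congr_fun h0 ((1, 0) : R × (ℕ → R)))) k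
  simp [freeAction_genF, genAction] at h1

lemma finite_mul_ne_zero_of_mem_closure {A ι : Type*} [Ring A] (e : ι → A) {T : Set A}
    (hT : ∀ x ∈ T, {i | x * e i ≠ 0}.Finite) {x : A} (hx : x ∈ AddSubgroup.closure T) :
    {i | x * e i ≠ 0}.Finite := by
  induction hx using AddSubgroup.closure_induction with
  | mem x hx => exact hT x hx
  | zero => simp
  | neg x _ hx => simpa using hx
  | add x y _ _ hx hy =>
    refine (hx.union hy).subset fun i hi => ?_
    by_contra h
    simp_all [add_mul]

section Graph

variable {R V Ed : Type*} [Ring R] {sf rf : Ed → V}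

lemma gen_mul_eq_of_rel {x y z : Gen V Ed}
    (h : Rel R sf rf (genF R x * genF R y) (genF R z)) :
    gen R sf rf x * gen R sf rf y = gen R sf rf z := by
  simpa [gen] using RingQuot.mkRingHom_rel h

lemma ghost_mul_edge_of_ne {f f' : Ed} (h : f ≠ f') :
    gen R sf rf (.ghost f) * gen R sf rf (.edge f') = 0 := by
  simpa [gen] using RingQuot.mkRingHom_rel (Rel.ghost_edge_ne (R := R) (sf := sf) (rf := rf) h)

/-- An element of a component of negative degree annihilates all but finitely many edges. -/
lemma finite_mul_edge_ne_zero {n : ℤ} (hn : n < 0) {c : LeavittPathAlgebra R sf rf}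
    (hc : c ∈ componentZ R sf rf n) : {f | c * gen R sf rf (.edge f) ≠ 0}.Finite := by
  refine finite_mul_ne_zero_of_mem_closure _ (fun x hx => ?_) hc
  obtain ⟨r, u, u', w, α, β, hd, rfl⟩ := hx
  cases β with
  | nil =>
    simp only [GPath.length] at hd
    lia
  | cons g p =>
    refine (Set.finite_singleton g).subset fun f hf => ?_
    by_contra h
    exact hf (by simp [ghostElem, mul_assoc, ghost_mul_edge_of_ne (Ne.symm h)])

lemma finite_mul_edge_ne_zero_of_mem_sgMul {B : AddSubgroup (LeavittPathAlgebra R sf rf)} {n : ℤ}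
    (hn : n < 0) {x : LeavittPathAlgebra R sf rf} (hx : x ∈ sgMul B (componentZ R sf rf n)) :
    {f | x * gen R sf rf (.edge f) ≠ 0}.Finite := by
  refine finite_mul_ne_zero_of_mem_closure _ (fun x hx => ?_) hx
  obtain ⟨b, _, c, hc, rfl⟩ := hx
  refine (finite_mul_edge_ne_zero hn hc).subset fun f hf h => hf ?_
  rw [mul_assoc, h, mul_zero]

lemma gen_edge_mem_componentZ (f : Ed) : gen R sf rf (.edge f) ∈ componentZ R sf rf 1 := by
  refine AddSubgroup.subset_closure ⟨1, _, _, _, .cons f (.nil _), .nil _, by simp [GPath.length], ?_⟩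
  have h1 : ofR R sf rf 1 = 1 := map_one (RingQuot.mkRingHom (Rel R sf rf))
  rw [h1, one_mul, realElem, realElem, ghostElem, gen_mul_eq_of_rel (.edge_rng f),
    gen_mul_eq_of_rel (.edge_rng f)]

end Graph

/-- No element of `S₁ S₋₁` acts as a left identity on all the edges of `C`. -/
lemma not_forall_mul_edge_eq (R : Type*) [Ring R] [Nontrivial R]
    {x : LeavittPathAlgebra R sC rC}
    (hx : x ∈ sgMul (componentZ R sC rC 1) (componentZ R sC rC (-1))) :
    ¬ ∀ k, x * gen R sC rC (.edge k) = gen R sC rC (.edge k) := by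
  intro h
  refine Set.infinite_univ
    ((finite_mul_edge_ne_zero_of_mem_sgMul (by norm_num) hx).subset fun k _ => ?_)
  rw [Set.mem_ofPred_eq, h k]
  exact gen_edge_ne_zero R k

/-- For the graph `C` with two vertices `v₁, v₂` and infinitely many
edges from `v₁` to `v₂`, and any nonzero unital ring `R`: in the canonical `ℤ`-gradation
of `L_R(C)` one has `v₁ ∉ S₁ S₋₁`; consequently `L_R(C)` is not epsilon-strongly
`ℤ`-graded. -/
theorem leavitt_infinite_emitter_not_epsilonStrongly (R : Type*) [Ring R] [Nontrivial R] :
    gen R sC rC (Gen.vertex 0) ∉ sgMul (componentZ R sC rC 1) (componentZ R sC rC (-1)) ∧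
    ¬ (∀ n : ℤ, ∃ ε ∈ sgMul (componentZ R sC rC n) (componentZ R sC rC (-n)),
        ∃ ε' ∈ sgMul (componentZ R sC rC (-n)) (componentZ R sC rC n),
          ∀ s ∈ componentZ R sC rC n, ε * s = s ∧ s * ε' = s) := by
  refine ⟨fun h => not_forall_mul_edge_eq R h fun k => gen_mul_eq_of_rel (.src_edge k),
    fun h => ?_⟩
  obtain ⟨ε, hε, _, _, hs⟩ := h 1
  exact not_forall_mul_edge_eq R hε fun k => (hs _ (gen_edge_mem_componentZ k)).1

end LPA
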